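/- Let α > 0 and β, β̃ ∈ ℂ. Then as |s| → ∞ with |Im s| → ∞ in a fixed vertical strip, log(Γ(αs+β̃)/Γ(α(1-s)+β)) = (αs+β̃-1/2) log s - (α(1-s)+β-1/2) log(-s) + 2(α log α - α)s + (β̃-β-α) log α + O(1/|s|), where log s and log(-s) are the principal branches. -/

import Mathlib

open Complex Real

lemma st_log_mul {w c : ℂ} (hw : 0 < w.re) (hc0 : c ≠ 0) (hc : |c.arg| ≤ π / 2) :
    Complex.log (w * c) = Complex.log w + Complex.log c := by
  have hw0 : w ≠ 0 := by rintro rfl; simp at hw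
  have h1 : |w.arg| < π / 2 := abs_arg_lt_pi_div_two_iff.2 (Or.inl hw)
  rw [abs_lt] at h1
  rw [abs_le] at hc
  exact Complex.log_mul hw0 hc0 ⟨by linarith, by linarith⟩

lemma st_log_I {s c : ℂ} (hc : c = I ∨ c = -I) (h : 0 < (s * c⁻¹).re) :
    Complex.log s = Complex.log (s * c⁻¹) + Complex.log c := by
  have hc0 : c ≠ 0 := by rcases hc with rfl | rfl <;> simp
  rw [← st_log_mul h hc0]
  · congr 1; field_simp
  · rcases hc with rfl | rfl
    · simp [abs_of_pos Real.pi_pos, abs_div]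
    · simp [abs_of_pos Real.pi_pos, abs_div]

lemma st_log_strip {s u : ℂ} (hu : 0 < u.re) (h : 0 < s.im * (s * u).im) :
    Complex.log (s * u) = Complex.log s + Complex.log u := by
  have key : ∃ c : ℂ, (c = I ∨ c = -I) ∧ 0 < (s * c⁻¹).re ∧ 0 < (s * u * c⁻¹).re := by
    rcases pos_and_pos_or_neg_and_neg_of_mul_pos h with ⟨h1, h2⟩ | ⟨h1, h2⟩
    · refine ⟨I, Or.inl rfl, by simpa using h1, ?_⟩
      rw [Complex.inv_I, mul_neg, Complex.neg_re, Complex.mul_I_re, neg_neg]; exact h2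
    · refine ⟨-I, Or.inr rfl, by simpa using h1, ?_⟩
      rw [inv_neg, Complex.inv_I, neg_neg, Complex.mul_I_re]; linarith
  obtain ⟨c, hc, h1, h2⟩ := key
  have hu0 : u ≠ 0 := by rintro rfl; simp at hu
  rw [st_log_I hc h1, st_log_I hc h2]
  have : s * u * c⁻¹ = (s * c⁻¹) * u := by ring
  rw [this, st_log_mul h1 hu0 (abs_arg_lt_pi_div_two_iff.2 (Or.inl hu)).le]
  ring

noncomputable def stF (z : ℂ) : ℂ := (z - 1/2) * Complex.log z - z
noncomputable def stG (z : ℂ) : ℂ := (z + 1/2) * (Complex.log (z + 1) - Complex.log z) - 1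

lemma stF_step (z : ℂ) : Complex.log z = stF (z + 1) - stF z - stG z := by
  unfold stF stG; ring

lemma stF_sum (z : ℂ) (n : ℕ) : ∑ k ∈ Finset.range n, Complex.log (z + k)
    = stF (z + n) - stF z - ∑ k ∈ Finset.range n, stG (z + k) := by
  induction n with
  | zero => simp
  | succ n ih =>
    rw [Finset.sum_range_succ, Finset.sum_range_succ, ih, stF_step (z + n)]
    push_cast
    rw [← add_assoc]; ring

lemma st_re_pos {x : ℂ} (hx : ‖x‖ ≤ 1/2) : 0 < (1 + x).re := by
  have := Complex.abs_re_le_norm x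
  have h2 := neg_abs_le x.re
  simp; linarith

lemma stG_bound {z : ℂ} (hz : z.im ≠ 0) (h2 : 2 ≤ ‖z‖) : ‖stG z‖ ≤ 2 / ‖z‖ ^ 2 := by
  have hz0 : z ≠ 0 := by rintro rfl; simp at hz
  set x : ℂ := z⁻¹ with hx
  have hxn : ‖x‖ ≤ 1/2 := by
    rw [hx, norm_inv]; rw [one_div]; exact inv_anti₀ (by norm_num) h2
  have hlog : Complex.log (z + 1) = Complex.log z + Complex.log (1 + x) := by
    have e : z + 1 = z * (1 + x) := by rw [hx]; field_simp
    rw [e, st_log_strip (st_re_pos hxn)]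
    rw [← e]; simpa using mul_self_pos.2 hz
  have hT := Complex.norm_log_sub_logTaylor_le 2 (z := x) (by linarith)
  have hTe : Complex.logTaylor (2 + 1) x = x - x ^ 2 / 2 := by
    simp [Complex.logTaylor_succ, Complex.logTaylor_zero]; ring
  rw [hTe] at hT
  set r : ℂ := Complex.log (1 + x) - (x - x ^ 2 / 2) with hr
  have hg : stG z = (z + 1/2) * r - x ^ 2 / 4 := by
    unfold stG
    have : Complex.log (1 + x) = r + (x - x ^ 2 / 2) := by rw [hr]; ring
    rw [hlog, this, hx]; field_simp; ring
  have hr2 : ‖r‖ ≤ ‖x‖ ^ 3 := by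
    refine hT.trans ?_
    have h1 : (1 - ‖x‖)⁻¹ ≤ 2 := by
      rw [inv_le_comm₀ (by linarith) (by norm_num)]; linarith
    have h3 : 0 ≤ ‖x‖ ^ 3 := by positivity
    norm_num
    nlinarith
  have hzn : ‖z‖ * ‖x‖ = 1 := by rw [← norm_mul, hx, mul_inv_cancel₀ hz0, norm_one]
  have hzz : ‖z + 1/2‖ ≤ ‖z‖ + 1/2 := by
    refine (norm_add_le _ _).trans ?_
    norm_num
  have e2 : 2 / ‖z‖ ^ 2 = 2 * ‖x‖ ^ 2 := by rw [hx, norm_inv]; field_simp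
  rw [hg, e2]
  calc ‖(z + 1/2) * r - x ^ 2 / 4‖ ≤ ‖(z + 1/2) * r‖ + ‖x ^ 2 / 4‖ := norm_sub_le _ _
    _ = ‖z + 1/2‖ * ‖r‖ + ‖x‖ ^ 2 / 4 := by simp
    _ ≤ (‖z‖ + 1/2) * ‖x‖ ^ 3 + ‖x‖ ^ 2 / 4 := by gcongr
    _ = (‖z‖ * ‖x‖) * ‖x‖ ^ 2 + ‖x‖ ^ 2 * ‖x‖ / 2 + ‖x‖ ^ 2 / 4 := by ring
    _ ≤ 2 * ‖x‖ ^ 2 := by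
      rw [hzn]
      have : ‖x‖ ^ 2 * ‖x‖ ≤ ‖x‖ ^ 2 * (1/2) := by gcongr
      nlinarith [sq_nonneg ‖x‖]

/-- sum bounds -/
lemma stG_term {z : ℂ} {Y : ℝ} (hY : 4 ≤ Y) (h : Y ≤ z.re + |z.im|) (hz : z.im ≠ 0) (k : ℕ) :
    ‖stG (z + k)‖ ≤ 4 * (1 / (k + Y - 1) - 1 / (k + Y)) := by
  have hk : (0:ℝ) ≤ k := Nat.cast_nonneg k
  have hn : (k + Y) ^ 2 ≤ 2 * ‖z + k‖ ^ 2 := by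
    rw [Complex.sq_norm, Complex.normSq_apply]
    simp
    have : (k + Y) ^ 2 ≤ (z.re + k + |z.im|) ^ 2 := by gcongr ?_ ^ 2; linarith
    nlinarith [sq_nonneg (z.re + k - |z.im|), sq_abs z.im]
  have h2 : 2 ≤ ‖z + k‖ := by
    by_contra hc
    push Not at hc
    have : ‖z + k‖ ^ 2 ≤ 2 ^ 2 := by gcongr
    nlinarith
  have hb := stG_bound (z := z + k) (by simpa using hz) h2
  refine hb.trans ?_
  have e : 4 * (1 / (k + Y - 1) - 1 / (k + Y)) = 4 / ((k + Y - 1) * (k + Y)) := by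
    have h1 : k + Y - 1 ≠ 0 := by intro h; linarith
    have h3 : k + Y ≠ 0 := by intro h; linarith
    field_simp; ring
  rw [e, div_le_div_iff₀ (by positivity) (by apply mul_pos <;> linarith)]
  nlinarith

lemma stG_sum {z : ℂ} {Y : ℝ} (hY : 4 ≤ Y) (h : Y ≤ z.re + |z.im|) (hz : z.im ≠ 0) :
    Summable (fun k : ℕ => stG (z + k)) ∧ ‖∑' k : ℕ, stG (z + k)‖ ≤ 8 / Y := by
  have hp : ∀ n : ℕ, ∑ k ∈ Finset.range n, ‖stG (z + k)‖ ≤ 4 * (1 / (Y - 1) - 1 / (n + Y - 1)) := by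
    intro n
    induction n with
    | zero => simp
    | succ n ih =>
      rw [Finset.sum_range_succ]
      have := stG_term hY h hz n
      have e : ((n + 1 : ℕ) : ℝ) + Y - 1 = n + Y := by push_cast; ring
      rw [e]; linarith
  have hp' : ∀ n : ℕ, ∑ k ∈ Finset.range n, ‖stG (z + k)‖ ≤ 8 / Y := by
    intro n
    refine (hp n).trans ?_
    have hn : (0:ℝ) ≤ n := Nat.cast_nonneg n
    have h1 : 0 ≤ 1 / ((n:ℝ) + Y - 1) := by apply div_nonneg <;> linarith
    have h3 : 4 * (1 / (Y - 1)) ≤ 8 / Y := by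
      rw [mul_one_div, div_le_div_iff₀ (by linarith) (by linarith)]; linarith
    linarith
  have hs : Summable (fun k : ℕ => ‖stG (z + k)‖) :=
    summable_of_sum_range_le (fun _ => norm_nonneg _) hp'
  exact ⟨hs.of_norm, (norm_tsum_le_tsum_norm hs).trans
    (Real.tsum_le_of_sum_range_le (fun _ => norm_nonneg _) hp')⟩

lemma stD_tendsto {z : ℂ} (hz : z.im ≠ 0) :
    Filter.Tendsto (fun n : ℕ => z * Complex.log n - stF (z + ((n + 1 : ℕ) : ℂ))
      + stF ((n + 1 : ℕ) : ℂ)) Filter.atTop (nhds 0) := by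
  have hg : Filter.Tendsto (fun n : ℕ => (n : ℂ) * (z / n)) Filter.atTop (nhds z) := by
    refine tendsto_const_nhds.congr' ?_
    filter_upwards [Filter.eventually_gt_atTop 0] with n hn
    have : (n : ℂ) ≠ 0 := by exact_mod_cast hn.ne'
    field_simp
  have h1 := (Complex.tendsto_nat_mul_log_one_add_of_tendsto hg)
  have h0 : Filter.Tendsto (fun n : ℕ => Complex.log (1 + z / n)) Filter.atTop (nhds 0) := by
    have hi : Filter.Tendsto (fun n : ℕ => ((n : ℂ))⁻¹) Filter.atTop (nhds 0) :=
      tendsto_inv_atTop_nhds_zero_nat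
    have := hi.mul h1
    rw [zero_mul] at this
    refine this.congr' ?_
    filter_upwards [Filter.eventually_gt_atTop 0] with n hn
    have : (n : ℂ) ≠ 0 := by exact_mod_cast hn.ne'
    field_simp
  have h1' := h1.comp (Filter.tendsto_add_atTop_nat 1)
  have h0' := h0.comp (Filter.tendsto_add_atTop_nat 1)
  have hl : Filter.Tendsto (fun n : ℕ => ((Real.log (n + 1) - Real.log n : ℝ) : ℂ))
      Filter.atTop (nhds 0) := by
    have := (Complex.continuous_ofReal.tendsto 0).comp Real.tendsto_log_nat_add_one_sub_log
    rw [Complex.ofReal_zero] at this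
    exact this
  have hall := (((hl.const_mul (-z)).sub h1').sub (h0'.const_mul (z - 1/2))).add_const z
  have e0 : -z * 0 - z - (z - 1/2) * 0 + z = 0 := by ring
  rw [e0] at hall
  refine hall.congr ?_
  intro n
  have hN : (((n + 1 : ℕ) : ℝ) : ℂ) = ((n + 1 : ℕ) : ℂ) := by simp
  have hN0 : ((n + 1 : ℕ) : ℂ) ≠ 0 := by exact_mod_cast Nat.succ_ne_zero n
  have hNp : (0 : ℝ) < ((n + 1 : ℕ) : ℝ) := by exact_mod_cast Nat.succ_pos n
  have hu : (1 + z / ((n + 1 : ℕ) : ℂ)) ≠ 0 := by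
    intro h
    have : z = -((n + 1 : ℕ) : ℂ) := by field_simp at h; linear_combination h
    apply hz; rw [this, Complex.neg_im, Complex.natCast_im, neg_zero]
  have e1 : Complex.log (z + ((n + 1 : ℕ) : ℂ)) =
      (Real.log ((n + 1 : ℕ) : ℝ) : ℂ) + Complex.log (1 + z / ((n + 1 : ℕ) : ℂ)) := by
    rw [← Complex.log_ofReal_mul hNp hu]
    congr 1
    rw [hN]; field_simp; ring
  have e2 : Complex.log ((n + 1 : ℕ) : ℂ) = (Real.log ((n + 1 : ℕ) : ℝ) : ℂ) := by
    rw [← hN, ← Complex.ofReal_log hNp.le]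
  have e3 : Complex.log (n : ℂ) = (Real.log (n : ℝ) : ℂ) := by
    rw [Complex.ofReal_log (Nat.cast_nonneg n)]; simp
  simp only [stF, Function.comp]
  rw [e1, e2, e3]
  push_cast
  ring

lemma stGammaSeq {z : ℂ} (hz : z.im ≠ 0) {n : ℕ} (hn : n ≠ 0) :
    Complex.GammaSeq z n = Complex.exp (stF z + ∑ k ∈ Finset.range (n + 1), stG (z + k)
      + (z * Complex.log n - stF (z + ((n + 1 : ℕ) : ℂ)) + stF ((n + 1 : ℕ) : ℂ)))
      * (n.factorial * Complex.exp (- stF ((n + 1 : ℕ) : ℂ))) := by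
  have hn0 : (n : ℂ) ≠ 0 := by exact_mod_cast hn
  have hprod : ∏ j ∈ Finset.range (n + 1), (z + j)
      = Complex.exp (∑ j ∈ Finset.range (n + 1), Complex.log (z + j)) := by
    rw [Complex.exp_sum]
    refine Finset.prod_congr rfl fun j _ => ?_
    rw [Complex.exp_log]
    intro h
    apply hz
    have := congrArg Complex.im h
    simpa using this
  unfold Complex.GammaSeq
  rw [hprod, stF_sum, Complex.cpow_def_of_ne_zero hn0, mul_comm (Complex.exp _) (n.factorial : ℂ),
    mul_div_assoc, ← Complex.exp_sub, mul_left_comm, ← Complex.exp_add]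
  congr 2
  ring

lemma stGamma_quot {z w : ℂ} (hz : z.im ≠ 0) (hw : w.im ≠ 0)
    (hzs : Summable (fun k : ℕ => stG (z + k))) (hws : Summable (fun k : ℕ => stG (w + k))) :
    Complex.Gamma z / Complex.Gamma w = Complex.exp ((stF z + ∑' k : ℕ, stG (z + k))
      - (stF w + ∑' k : ℕ, stG (w + k))) := by
  have hw0 : Complex.Gamma w ≠ 0 := by
    apply Complex.Gamma_ne_zero
    intro m h
    apply hw; rw [h]; simp
  have hA := (Complex.GammaSeq_tendsto_Gamma z).div (Complex.GammaSeq_tendsto_Gamma w) hw0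
  have hT : ∀ {v : ℂ}, v.im ≠ 0 → Summable (fun k : ℕ => stG (v + k)) → Filter.Tendsto
      (fun n : ℕ => stF v + ∑ k ∈ Finset.range (n + 1), stG (v + k)
      + (v * Complex.log n - stF (v + ((n + 1 : ℕ) : ℂ)) + stF ((n + 1 : ℕ) : ℂ)))
      Filter.atTop (nhds (stF v + ∑' k : ℕ, stG (v + k))) := by
    intro v hv hvs
    have h1 := hvs.hasSum.tendsto_sum_nat.comp (Filter.tendsto_add_atTop_nat 1)
    have := (h1.const_add (stF v)).add (stD_tendsto hv)
    rw [add_zero] at this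
    exact this
  have hB := (Complex.continuous_exp.tendsto _).comp ((hT hz hzs).sub (hT hw hws))
  refine tendsto_nhds_unique_of_eventuallyEq hA hB ?_
  filter_upwards [Filter.eventually_ne_atTop 0] with n hn
  simp only [Pi.div_apply, Function.comp]
  rw [stGammaSeq hz hn, stGammaSeq hw hn, Complex.exp_sub, mul_div_mul_right]
  exact mul_ne_zero (by exact_mod_cast n.factorial_ne_zero) (Complex.exp_ne_zero _)

lemma st_asym (α : ℝ) (hα : 0 < α) (p : ℂ) (M : ℝ) (hM : 0 ≤ M) :
    ∃ C S : ℝ, 0 < C ∧ 0 < S ∧ ∀ s : ℂ, |s.re| ≤ M → S ≤ |s.im| →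
      ((α : ℂ) * s + p).im ≠ 0 ∧ Summable (fun k : ℕ => stG ((α : ℂ) * s + p + k)) ∧
      ∃ E : ℂ, ‖E‖ ≤ C / ‖s‖ ∧
        stF ((α : ℂ) * s + p) + ∑' k : ℕ, stG ((α : ℂ) * s + p + k)
          = ((α : ℂ) * s + p - 1/2) * ((Real.log α : ℂ) + Complex.log s) - α * s + E := by
  have hp := norm_nonneg p
  refine ⟨(3 * ‖p‖ + 1) * ‖p‖ / α + 32 / α, 2 * M + (4 * ‖p‖ + 8) / α, by positivity,
    by positivity, ?_⟩
  intro s hre hS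
  set y := |s.im| with hy
  have hS' : 2 * (α * M) + 4 * ‖p‖ + 8 ≤ α * y := by
    have : α * (2 * M + (4 * ‖p‖ + 8) / α) ≤ α * y := by gcongr
    have e : α * (2 * M + (4 * ‖p‖ + 8) / α) = 2 * (α * M) + 4 * ‖p‖ + 8 := by field_simp; ring
    linarith
  have hαM : 0 ≤ α * M := by positivity
  have hy0 : 0 < y := by
    by_contra h; push Not at h
    nlinarith
  have hsy : y ≤ ‖s‖ := Complex.abs_im_le_norm s
  have hs0 : 0 < ‖s‖ := by linarith
  have hsne : s ≠ 0 := norm_pos_iff.1 hs0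
  have hαc : (α : ℂ) ≠ 0 := by exact_mod_cast hα.ne'
  have hMy : M ≤ y := by
    by_contra h; push Not at h
    nlinarith
  have hs2 : ‖s‖ ≤ 2 * y := by
    have := Complex.norm_le_abs_re_add_abs_im s
    linarith
  have hpr := Complex.abs_re_le_norm p
  have hpi := Complex.abs_im_le_norm p
  have hzre : ((α : ℂ) * s + p).re = α * s.re + p.re := by simp
  have hzim : ((α : ℂ) * s + p).im = α * s.im + p.im := by simp
  have hsign : 0 < (α * s.im) * (α * s.im + p.im) := by
    have h1 : |α * s.im| = α * y := by rw [abs_mul, abs_of_pos hα]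
    have h2 : (α * s.im) ^ 2 = (α * y) ^ 2 := by rw [← sq_abs, h1]
    have h3 : |(α * s.im) * p.im| ≤ (α * y) * ‖p‖ := by
      rw [abs_mul, h1]; gcongr
    have h4 := neg_abs_le ((α * s.im) * p.im)
    nlinarith
  have him : ((α : ℂ) * s + p).im ≠ 0 := by
    rw [hzim]; intro h; rw [h] at hsign; simp at hsign
  have hY : α * y / 2 ≤ ((α : ℂ) * s + p).re + |((α : ℂ) * s + p).im| := by
    rw [hzre, hzim]
    have h1 : α * y - ‖p‖ ≤ |α * s.im + p.im| := by
      have h := abs_sub_abs_le_abs_sub (α * s.im) (-p.im)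
      rw [abs_mul, abs_of_pos hα, abs_neg, sub_neg_eq_add] at h
      linarith
    have h2 : -(α * M) ≤ α * s.re := by
      have : -M ≤ s.re := by linarith [neg_abs_le s.re]
      nlinarith
    have h3 := neg_abs_le p.re
    linarith
  obtain ⟨hsum, hmu⟩ := stG_sum (by linarith) hY him
  refine ⟨him, hsum, ?_⟩
  set μ := ∑' k : ℕ, stG ((α : ℂ) * s + p + k) with hμ
  set x : ℂ := p / (α * s) with hx
  have hαs : (α : ℂ) * s ≠ 0 := mul_ne_zero hαc hsne
  have hxs : (α : ℂ) * s * x = p := by rw [hx]; field_simp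
  have hnα : ‖(α : ℂ)‖ = α := by simp [abs_of_pos hα]
  have hxn : α * ‖s‖ * ‖x‖ = ‖p‖ := by
    rw [← hxs, norm_mul, norm_mul, hnα]
  have hx2 : ‖x‖ ≤ 1/2 := by
    by_contra h; push Not at h
    have : α * y ≤ α * ‖s‖ := by gcongr
    nlinarith
  have hlog : Complex.log ((α : ℂ) * s + p)
      = (Real.log α : ℂ) + Complex.log s + Complex.log (1 + x) := by
    have e : (α : ℂ) * s + p = (α : ℂ) * s * (1 + x) := by rw [mul_add, hxs, mul_one]
    rw [← Complex.log_ofReal_mul hα hsne, e]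
    apply st_log_strip (st_re_pos hx2)
    rw [← e, hzim]; simpa using hsign
  set r : ℂ := Complex.log (1 + x) - x with hr
  have hr2 : ‖r‖ ≤ ‖x‖ ^ 2 := by
    refine (Complex.norm_log_one_add_sub_self_le (by linarith)).trans ?_
    have h1 : (1 - ‖x‖)⁻¹ ≤ 2 := by
      rw [inv_le_comm₀ (by linarith) (by norm_num)]; linarith
    have h3 : 0 ≤ ‖x‖ ^ 2 := by positivity
    nlinarith
  refine ⟨(p - 1/2) * x + ((α : ℂ) * s + p - 1/2) * r + μ, ?_, ?_⟩
  · have hp12 : ‖p - 1/2‖ ≤ ‖p‖ + 1/2 := by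
      refine (norm_sub_le _ _).trans ?_
      norm_num
    have hz12 : ‖(α : ℂ) * s + p - 1/2‖ ≤ α * ‖s‖ + (‖p‖ + 1/2) := by
      rw [add_sub_assoc]
      refine (norm_add_le _ _).trans ?_
      rw [norm_mul, hnα]; linarith
    have hxe : ‖x‖ = ‖p‖ / (α * ‖s‖) := by rw [← hxn]; field_simp
    have hmu2 : ‖μ‖ ≤ 32 / α / ‖s‖ := by
      refine hmu.trans ?_
      rw [div_div, div_le_div_iff₀ (by positivity) (by positivity)]
      nlinarith
    have hxx : ‖x‖ ^ 2 ≤ ‖x‖ := by nlinarith [norm_nonneg x]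
    calc ‖(p - 1/2) * x + ((α : ℂ) * s + p - 1/2) * r + μ‖
        ≤ ‖p - 1/2‖ * ‖x‖ + ‖(α : ℂ) * s + p - 1/2‖ * ‖r‖ + ‖μ‖ := by
          refine (norm_add₃_le).trans ?_
          rw [norm_mul, norm_mul]
      _ ≤ (‖p‖ + 1/2) * ‖x‖ + (α * ‖s‖ + (‖p‖ + 1/2)) * ‖x‖ ^ 2 + 32 / α / ‖s‖ := by gcongr
      _ = (‖p‖ + 1/2) * ‖x‖ + (α * ‖s‖ * ‖x‖) * ‖x‖ + (‖p‖ + 1/2) * ‖x‖ ^ 2 + 32 / α / ‖s‖ := by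
          ring
      _ ≤ (‖p‖ + 1/2) * ‖x‖ + ‖p‖ * ‖x‖ + (‖p‖ + 1/2) * ‖x‖ + 32 / α / ‖s‖ := by
          rw [hxn]; gcongr
      _ = (3 * ‖p‖ + 1) * ‖x‖ + 32 / α / ‖s‖ := by ring
      _ = ((3 * ‖p‖ + 1) * ‖p‖ / α + 32 / α) / ‖s‖ := by rw [hxe]; field_simp
  · have hl2 : Complex.log (1 + x) = x + r := by rw [hr]; ring
    unfold stF
    rw [hlog, hl2]
    linear_combination hxs

/-- Stirling-type asymptotic for the quotient `Γ(αs+β̃)/Γ(α(1-s)+β)` in a vertical strip: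
the quotient equals the exponential of the stated main terms plus an error `O(1/|s|)`. -/
theorem stmt6 (α : ℝ) (hα : 0 < α) (β β' : ℂ) (a b : ℝ) (hab : a ≤ b) :
    ∃ C S : ℝ, 0 < C ∧ 0 < S ∧ ∀ s : ℂ, a ≤ s.re → s.re ≤ b → S ≤ |s.im| →
      ∃ E : ℂ, ‖E‖ ≤ C / ‖s‖ ∧
        Complex.Gamma ((α : ℂ) * s + β') / Complex.Gamma ((α : ℂ) * (1 - s) + β)
          = Complex.exp
              (((α : ℂ) * s + β' - 1/2) * Complex.log s
                - ((α : ℂ) * (1 - s) + β - 1/2) * Complex.log (-s)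
                + 2 * ((α : ℝ) * Real.log α - α : ℝ) * s
                + (β' - β - (α : ℂ)) * (Real.log α : ℂ)
                + E) := by
  obtain ⟨C₁, S₁, hC₁, hS₁, h₁⟩ := st_asym α hα β' (max |a| |b|) (by positivity)
  obtain ⟨C₂, S₂, hC₂, hS₂, h₂⟩ := st_asym α hα (α + β) (max |a| |b|) (by positivity)
  refine ⟨C₁ + C₂, max S₁ S₂, by positivity, by positivity, ?_⟩
  intro s hsa hsb hs
  have hre : |s.re| ≤ max |a| |b| := abs_le_max_abs_abs hsa hsb
  obtain ⟨hz, hzs, E₁, hE₁, e₁⟩ := h₁ s hre ((le_max_left _ _).trans hs)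
  obtain ⟨hw, hws, E₂, hE₂, e₂⟩ := h₂ (-s) (by simpa using hre)
    (by simpa using (le_max_right _ _).trans hs)
  refine ⟨E₁ - E₂, ?_, ?_⟩
  · rw [norm_neg] at hE₂
    rw [add_div]
    exact (norm_sub_le _ _).trans (add_le_add hE₁ hE₂)
  · have ew : (α : ℂ) * (1 - s) + β = (α : ℂ) * (-s) + (α + β) := by ring
    rw [ew, stGamma_quot hz hw hzs hws, e₁, e₂]
    congr 1
    push_cast
    ring
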